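/- Let M ≥ 2 be an integer. Define the perceptiveness of the conditioned Behavioral entropy family as P(H^B) = sup_{α ∈ (0,1)∪(1,∞)} S(H^B_{α,β_α}) - inf_{α ∈ (0,1)∪(1,∞)} S(H^B_{α,β_α}), and the perceptiveness of the Renyi entropy family as P(H^R) = sup_{γ ∈ (0,1)∪(1,∞)} S(H^R_γ) - inf_{γ ∈ (0,1)∪(1,∞)} S(H^R_γ). Then P(H^B) > P(H^R) > 0. -/

import Mathlib

open MeasureTheory Real Filter Topology

/-- Prelec's probability weighting function: `w(p) = exp(-β(-log p)^α)` for `p ≠ 0`, `w(0) = 0`. -/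
noncomputable def prelec (α β p : ℝ) : ℝ :=
  if p = 0 then 0 else Real.exp (-β * (-Real.log p) ^ α)

/-- The conditioned Prelec parameter `β_α = (log M)^(1-α)` ensuring the fixed point is `1/M`. -/
noncomputable def betaCond (M : ℕ) (α : ℝ) : ℝ := (Real.log M) ^ (1 - α)

/-- Behavioral entropy `H^B_{α,β}(p) = -∑ i, w(p_i) log (w(p_i))` (note `Real.log 0 = 0`,
so the convention `0 · log 0 = 0` holds automatically). -/
noncomputable def behEnt (α β : ℝ) {M : ℕ} (p : Fin M → ℝ) : ℝ :=
  -∑ i, prelec α β (p i) * Real.log (prelec α β (p i))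

/-- The simplex `Δ_n = {x ∈ ℝⁿ : xᵢ ≥ 0, ∑ xᵢ ≤ 1}` parametrizing the probability simplex. -/
def simplexDomain (n : ℕ) : Set (Fin n → ℝ) := {x | (∀ i, 0 ≤ x i) ∧ ∑ i, x i ≤ 1}

/-- Parametrization of the probability simplex `P_M` by `Δ_{M-1}`:
`p = (x_1, …, x_{M-1}, 1 - ∑ x_i)`. -/
noncomputable def simplexParam (M : ℕ) (x : Fin (M - 1) → ℝ) : Fin M → ℝ :=
  fun i => if h : (i : ℕ) < M - 1 then x ⟨(i : ℕ), h⟩ else 1 - ∑ j, x j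

/-- The sensitivity `S(H)` of `H : P_M → ℝ`: the Lebesgue integral of `H` over the
parametrized probability simplex. -/
noncomputable def sens (M : ℕ) (H : (Fin M → ℝ) → ℝ) : ℝ :=
  ∫ x in simplexDomain (M - 1), H (simplexParam M x)

/-- Renyi entropy `H^R_γ(p) = (1/(1-γ)) log (∑ i, p_i^γ)`. -/
noncomputable def renyiEnt (γ : ℝ) {M : ℕ} (p : Fin M → ℝ) : ℝ :=
  (1 / (1 - γ)) * Real.log (∑ i, p i ^ γ)

/-- Min-entropy `-log (max_i p_i)`. -/
noncomputable def minEnt {M : ℕ} (p : Fin M → ℝ) : ℝ := -Real.log (⨆ i, p i)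

/-! ### The simplex and its parametrization -/

lemma measurable_simplexParam (M : ℕ) (i : Fin M) :
    Measurable fun x : Fin (M - 1) → ℝ => simplexParam M x i := by
  unfold simplexParam
  by_cases h : (i : ℕ) < M - 1
  · simp only [h, dite_true]
    fun_prop
  · simp only [h, dite_false]
    fun_prop

lemma sum_simplexParam {M : ℕ} (hM : 1 ≤ M) (x : Fin (M - 1) → ℝ) :
    ∑ i, simplexParam M x i = 1 := by
  obtain ⟨n, rfl⟩ : ∃ n, M = n + 1 := ⟨M - 1, by omega⟩
  rw [Fin.sum_univ_castSucc]
  simp [simplexParam]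

lemma simplexParam_nonneg {M : ℕ} {x : Fin (M - 1) → ℝ} (hx : x ∈ simplexDomain (M - 1))
    (i : Fin M) : 0 ≤ simplexParam M x i := by
  unfold simplexParam
  split_ifs
  · exact hx.1 _
  · exact sub_nonneg.2 hx.2

lemma measurableSet_simplexDomain (n : ℕ) : MeasurableSet (simplexDomain n) := by
  refine MeasurableSet.inter (s₁ := {x : Fin n → ℝ | ∀ i, 0 ≤ x i})
    (s₂ := {x : Fin n → ℝ | ∑ i, x i ≤ 1}) ?_ ?_
  · rw [Set.ofPred_forall]
    exact MeasurableSet.iInter fun i => measurableSet_le measurable_const (measurable_pi_apply i)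
  · exact measurableSet_le (by fun_prop) measurable_const

lemma volume_simplexDomain_lt_top (n : ℕ) : volume (simplexDomain n) < ⊤ := by
  refine (measure_mono (t := Set.Icc 0 1) fun x hx => ⟨fun i => hx.1 i, fun i => ?_⟩).trans_lt
    isCompact_Icc.measure_lt_top
  exact (Finset.single_le_sum (fun j _ => hx.1 j) (Finset.mem_univ i)).trans hx.2

lemma volume_simplexDomain_ne_zero (n : ℕ) : volume (simplexDomain n) ≠ 0 := by
  have hpos : (0 : ℝ) < 1 / (n + 1) := by positivity
  have hsub : Set.univ.pi (fun _ : Fin n => Set.Ioo (0 : ℝ) (1 / (n + 1))) ⊆ simplexDomain n := by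
    intro x hx
    refine ⟨fun i => (hx i trivial).1.le, ?_⟩
    calc ∑ i, x i ≤ ∑ _i : Fin n, (1 : ℝ) / (n + 1) :=
          Finset.sum_le_sum fun i _ => (hx i trivial).2.le
      _ ≤ 1 := by
          rw [Finset.sum_const, Finset.card_univ, Fintype.card_fin, nsmul_eq_mul, mul_one_div,
            div_le_one (by positivity)]
          linarith
  intro h
  have h0 := measure_mono_null hsub h
  refine (IsOpen.measure_pos volume (isOpen_set_pi Set.finite_univ fun _ _ => isOpen_Ioo)
    ?_).ne' h0
  exact Set.univ_pi_nonempty_iff.2 fun _ => Set.nonempty_Ioo.2 hpos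

instance isFiniteMeasure_simplexDomain (n : ℕ) :
    IsFiniteMeasure (volume.restrict (simplexDomain n)) :=
  isFiniteMeasure_restrict.2 (volume_simplexDomain_lt_top n).ne

lemma ae_simplexParam_ne {M : ℕ} (hM : 2 ≤ M) (i : Fin M) (c : ℝ) :
    ∀ᵐ x : Fin (M - 1) → ℝ, simplexParam M x i ≠ c := by
  have : Nonempty (Fin (M - 1)) := ⟨⟨0, by omega⟩⟩
  rw [ae_iff]
  simp only [not_not]
  by_cases h : (i : ℕ) < M - 1
  · simp only [simplexParam, h, dite_true]
    exact Measure.pi_hyperplane (fun _ : Fin (M - 1) => (volume : Measure ℝ)) ⟨i, h⟩ c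
  · simp only [simplexParam, h, dite_false]
    let L : (Fin (M - 1) → ℝ) →ₗ[ℝ] ℝ := ∑ j, LinearMap.proj j
    have hL : ∀ x, L x = ∑ j, x j := fun x => by simp [L]
    let S : AffineSubspace ℝ (Fin (M - 1) → ℝ) :=
      (affineSpan ℝ {1 - c}).comap L.toAffineMap
    have hS : ∀ x, x ∈ S ↔ 1 - ∑ j, x j = c := fun x => by
      simp only [S, AffineSubspace.mem_comap, AffineSubspace.mem_affineSpan_singleton,
        LinearMap.coe_toAffineMap, hL]
      constructor <;> intro h <;> linarith
    have hne : S ≠ ⊤ := by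
      intro htop
      have h0 := (hS 0).1 (htop ▸ AffineSubspace.mem_top _ _ _)
      have h1 := (hS (Pi.single (Classical.arbitrary _) 1)).1
        (htop ▸ AffineSubspace.mem_top _ _ _)
      simp at h0 h1
      linarith
    convert Measure.addHaar_affineSubspace volume S hne using 2
    ext x
    exact (hS x).symm

lemma ae_simplexParam_interior {M : ℕ} (hM : 2 ≤ M) :
    ∀ᵐ x ∂volume.restrict (simplexDomain (M - 1)),
      ∀ i, 0 < simplexParam M x i ∧ simplexParam M x i < 1 ∧ simplexParam M x i ≠ 1 / M := by
  have h : ∀ᵐ x : Fin (M - 1) → ℝ, ∀ i, simplexParam M x i ≠ 0 ∧ simplexParam M x i ≠ 1 ∧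
      simplexParam M x i ≠ 1 / M := ae_all_iff.2 fun i =>
    (ae_simplexParam_ne hM i 0).and ((ae_simplexParam_ne hM i 1).and (ae_simplexParam_ne hM i _))
  filter_upwards [ae_restrict_mem (measurableSet_simplexDomain _), ae_restrict_of_ae h]
    with x hx h i
  have hn := simplexParam_nonneg hx
  refine ⟨(hn i).lt_of_ne (h i).1.symm, lt_of_le_of_ne ?_ (h i).2.1, (h i).2.2⟩
  rw [← sum_simplexParam (by omega : 1 ≤ M) x]
  exact Finset.single_le_sum (fun j _ => hn j) (Finset.mem_univ i)

lemma integral_pos_of_ae_pos {X : Type*} [MeasurableSpace X] {μ : Measure X} (hμ : μ ≠ 0)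
    {f : X → ℝ} (hf : Integrable f μ) (hpos : ∀ᵐ x ∂μ, 0 < f x) : 0 < ∫ x, f x ∂μ := by
  rw [integral_pos_iff_support_of_nonneg_ae (hpos.mono fun _ h => h.le) hf]
  have : μ (Function.support f) = μ Set.univ :=
    measure_congr (eventuallyEq_univ.2 (hpos.mono fun _ h => h.ne'))
  rw [this]
  exact Measure.measure_univ_pos.2 hμ

/-! ### Renyi entropy -/

section Renyi

variable {M : ℕ} {p : Fin M → ℝ}

lemma sum_rpow_pos (hp : ∀ i, 0 ≤ p i) (hs : ∑ i, p i = 1) (γ : ℝ) : 0 < ∑ i, p i ^ γ := by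
  obtain ⟨i, hi⟩ : ∃ i, 0 < p i := by
    by_contra! h
    have := Finset.sum_nonpos fun i (_ : i ∈ Finset.univ) => h i
    linarith
  exact Finset.sum_pos' (fun j _ => rpow_nonneg (hp j) γ)
    ⟨i, Finset.mem_univ i, rpow_pos_of_pos hi γ⟩

lemma renyiEnt_le_log (hM : 1 ≤ M) (hp : ∀ i, 0 ≤ p i) (hs : ∑ i, p i = 1) {γ : ℝ} (hγ : 0 < γ)
    (hγ1 : γ ≠ 1) : renyiEnt γ p ≤ log M := by
  have hM0 : (0 : ℝ) < M := by exact_mod_cast hM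
  have hpos := sum_rpow_pos hp hs γ
  unfold renyiEnt
  rcases lt_or_gt_of_ne hγ1 with h | h
  · have key := Real.rpow_sum_le_const_mul_sum_rpow_of_nonneg Finset.univ (f := fun i => p i ^ γ)
      (one_le_one_div hγ h.le) fun i _ => rpow_nonneg (hp i) γ
    simp only [Finset.card_univ, Fintype.card_fin, one_div, rpow_rpow_inv (hp _) hγ.ne', hs,
      mul_one] at key
    have := log_le_log (rpow_pos_of_pos hpos _) key
    rw [log_rpow hpos, log_rpow hM0, inv_mul_le_iff₀ hγ] at this
    rw [one_div, inv_mul_le_iff₀ (by linarith)]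
    calc _ ≤ _ := this
      _ = _ := by field_simp
  · have key := Real.rpow_sum_le_const_mul_sum_rpow_of_nonneg Finset.univ h.le fun i _ => hp i
    simp only [Finset.card_univ, Fintype.card_fin, hs, one_rpow] at key
    have := log_nonneg key
    rw [log_mul (rpow_pos_of_pos hM0 _).ne' hpos.ne', log_rpow hM0] at this
    rw [show 1 / (1 - γ) * log (∑ i, p i ^ γ) = (-log (∑ i, p i ^ γ)) / (γ - 1) by
      rw [← neg_sub γ 1, one_div, inv_neg]; ring, div_le_iff₀ (by linarith)]
    linarith

lemma minEnt_le_renyiEnt (hp : ∀ i, 0 ≤ p i) (hs : ∑ i, p i = 1) {γ : ℝ} (hγ : 0 < γ)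
    (hγ1 : γ ≠ 1) : minEnt p ≤ renyiEnt γ p := by
  have hle : ∀ i, p i ≤ ⨆ j, p j := le_ciSup (Set.finite_range p).bddAbove
  have hpos := sum_rpow_pos hp hs γ
  have hm0 : 0 < ⨆ j, p j := by
    by_contra! h
    have := Finset.sum_nonpos fun i (_ : i ∈ Finset.univ) => (hle i).trans h
    linarith
  have hsplit : ∀ i, p i ^ γ = p i * p i ^ (γ - 1) := fun i => by
    rcases (hp i).eq_or_lt with h | h
    · rw [← h, zero_rpow hγ.ne', zero_mul]
    · rw [rpow_sub_one h.ne']; field_simp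
  have hmean : ∑ i, p i * (⨆ j, p j) ^ (γ - 1) = (⨆ j, p j) ^ (γ - 1) := by
    rw [← Finset.sum_mul, hs, one_mul]
  unfold renyiEnt minEnt
  rcases lt_or_gt_of_ne hγ1 with h | h
  · have key : (⨆ j, p j) ^ (γ - 1) ≤ ∑ i, p i ^ γ := by
      rw [← hmean]
      refine Finset.sum_le_sum fun i _ => ?_
      rw [hsplit]
      rcases (hp i).eq_or_lt with h0 | h0
      · simp [← h0]
      · exact mul_le_mul_of_nonneg_left
          (rpow_le_rpow_of_nonpos h0 (hle i) (by linarith)) (hp i)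
    have := log_le_log (rpow_pos_of_pos hm0 _) key
    rw [log_rpow hm0] at this
    rw [one_div, le_inv_mul_iff₀ (by linarith)]
    linarith
  · have key : ∑ i, p i ^ γ ≤ (⨆ j, p j) ^ (γ - 1) := by
      rw [← hmean]
      refine Finset.sum_le_sum fun i _ => ?_
      rw [hsplit]
      exact mul_le_mul_of_nonneg_left (rpow_le_rpow (hp i) (hle i) (by linarith)) (hp i)
    have := log_le_log hpos key
    rw [log_rpow hm0] at this
    rw [show 1 / (1 - γ) * log (∑ i, p i ^ γ) = (-log (∑ i, p i ^ γ)) / (γ - 1) by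
      rw [← neg_sub γ 1, one_div, inv_neg]; ring, le_div_iff₀ (by linarith)]
    linarith

lemma minEnt_pos (hM : 1 ≤ M) (hp : ∀ i, 0 < p i) (hp1 : ∀ i, p i < 1) : 0 < minEnt p := by
  have : Nonempty (Fin M) := ⟨⟨0, hM⟩⟩
  obtain ⟨i, hi⟩ := exists_eq_ciSup_of_finite (f := p)
  rw [minEnt, ← hi]
  exact neg_pos.2 (log_neg (hp i) (hp1 i))

lemma renyiEnt_two_lt_log (hM : 1 ≤ M) (hp : ∀ i, 0 ≤ p i) (hs : ∑ i, p i = 1)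
    (hne : ∀ i, p i ≠ 1 / M) : renyiEnt 2 p < log M := by
  have hM0 : (0 : ℝ) < M := by exact_mod_cast hM
  have : Nonempty (Fin M) := ⟨⟨0, hM⟩⟩
  have hpos := sum_rpow_pos hp hs 2
  have hsq : 0 < ∑ i, (p i - 1 / M) ^ 2 :=
    Finset.sum_pos (fun i _ => sq_pos_of_ne_zero (sub_ne_zero.2 (hne i))) Finset.univ_nonempty
  have hexp : ∑ i, (p i - 1 / M) ^ 2 = ∑ i, p i ^ (2 : ℝ) - 1 / M := by
    simp only [rpow_two, sub_sq, Finset.sum_add_distrib, Finset.sum_sub_distrib, ← Finset.sum_mul,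
      ← Finset.mul_sum, hs, Finset.sum_const, Finset.card_univ, Fintype.card_fin, nsmul_eq_mul]
    field_simp
    ring
  have := log_lt_log (by positivity) (show 1 / (M : ℝ) < ∑ i, p i ^ (2 : ℝ) by linarith)
  rw [one_div, log_inv] at this
  unfold renyiEnt
  norm_num
  norm_num at this
  linarith

lemma tendsto_renyiEnt_zero (hM : 1 ≤ M) (hp : ∀ i, 0 < p i) :
    Tendsto (fun γ => renyiEnt γ p) (𝓝[>] 0) (𝓝 (log M)) := by
  have hM0 : (0 : ℝ) < M := by exact_mod_cast hM
  have hcont : ContinuousAt (fun γ : ℝ => 1 / (1 - γ) * log (∑ i, p i ^ γ)) 0 := by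
    have hsum : ContinuousAt (fun γ : ℝ => ∑ i, p i ^ γ) 0 :=
      tendsto_finsetSum _ fun i _ => continuousAt_const_rpow (hp i).ne'
    refine ContinuousAt.mul ?_ (hsum.log ?_)
    · exact ContinuousAt.div continuousAt_const (by fun_prop) (by norm_num)
    · simpa using hM0.ne'
  have := hcont.tendsto
  simp only [sub_zero, div_one, one_mul, rpow_zero, Finset.sum_const, Finset.card_univ,
    Fintype.card_fin, nsmul_eq_mul, mul_one] at this
  exact this.mono_left nhdsWithin_le_nhds

end Renyi

/-! ### Behavioral entropy -/

section Behavioral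

variable {M : ℕ} {p : Fin M → ℝ}

lemma mul_exp_neg_le_one (v : ℝ) : v * exp (-v) ≤ 1 := by
  rw [exp_neg, ← div_eq_mul_inv, div_le_one (exp_pos v)]
  linarith [add_one_le_exp v]

lemma neg_prelec_mul_log_mem_Icc {α β q : ℝ} (hβ : 0 ≤ β) (h0 : 0 ≤ q) (h1 : q ≤ 1) :
    -(prelec α β q * log (prelec α β q)) ∈ Set.Icc (0 : ℝ) 1 := by
  unfold prelec
  split_ifs
  · simp
  · have hv : 0 ≤ β * (-log q) ^ α :=
      mul_nonneg hβ (rpow_nonneg (neg_nonneg.2 (log_nonpos h0 h1)) α)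
    rw [log_exp, neg_mul β]
    constructor
    · nlinarith [exp_pos (-(β * (-log q) ^ α))]
    · linarith [mul_exp_neg_le_one (β * (-log q) ^ α)]

lemma behEnt_mem_Icc {α β : ℝ} (hβ : 0 ≤ β) (h0 : ∀ i, 0 ≤ p i) (h1 : ∀ i, p i ≤ 1) :
    behEnt α β p ∈ Set.Icc (0 : ℝ) M := by
  rw [behEnt, ← Finset.sum_neg_distrib]
  have h := fun i => neg_prelec_mul_log_mem_Icc (α := α) hβ (h0 i) (h1 i)
  refine ⟨Finset.sum_nonneg fun i _ => (h i).1, ?_⟩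
  simpa using Finset.sum_le_sum fun i (_ : i ∈ Finset.univ) => (h i).2

lemma behEnt_eq_sum_mul_exp {α β : ℝ} (h0 : ∀ i, 0 < p i) :
    behEnt α β p = ∑ i, β * (-log (p i)) ^ α * exp (-(β * (-log (p i)) ^ α)) := by
  rw [behEnt, ← Finset.sum_neg_distrib]
  refine Finset.sum_congr rfl fun i _ => ?_
  rw [prelec, if_neg (h0 i).ne', log_exp]
  ring_nf

lemma tendsto_behEnt_zero (hM : 2 ≤ M) (h0 : ∀ i, 0 < p i) (h1 : ∀ i, p i < 1) :
    Tendsto (fun α => behEnt α (betaCond M α) p) (𝓝[>] 0) (𝓝 (log M)) := by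
  have hM0 : (0 : ℝ) < M := by exact_mod_cast (by omega : 0 < M)
  have hlog : 0 < log M := log_pos (by exact_mod_cast hM)
  have hcont : ContinuousAt (fun α : ℝ => ∑ i, log M ^ (1 - α) * (-log (p i)) ^ α *
      exp (-(log M ^ (1 - α) * (-log (p i)) ^ α))) 0 := by
    refine tendsto_finsetSum _ fun i _ => ?_
    have hv : ContinuousAt (fun α : ℝ => log M ^ (1 - α) * (-log (p i)) ^ α) 0 := by
      have hl : -log (p i) ≠ 0 := (neg_pos.2 (log_neg (h0 i) (h1 i))).ne'
      exact (continuousAt_const.rpow (by fun_prop) (Or.inl hlog.ne')).mul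
        (continuousAt_const_rpow hl)
    exact (hv.mul hv.neg.rexp).tendsto
  have := hcont.tendsto
  simp only [sub_zero, rpow_one, rpow_zero, mul_one, exp_neg, exp_log hM0, Finset.sum_const,
    Finset.card_univ, Fintype.card_fin, nsmul_eq_mul] at this
  rw [show (M : ℝ) * (log M * (M : ℝ)⁻¹) = log M by field_simp] at this
  simp only [behEnt_eq_sum_mul_exp h0, betaCond, exp_neg]
  exact this.mono_left nhdsWithin_le_nhds

lemma tendsto_behEnt_atTop (hM : 2 ≤ M) (h0 : ∀ i, 0 < p i) (h1 : ∀ i, p i < 1)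
    (hne : ∀ i, p i ≠ 1 / M) :
    Tendsto (fun α => behEnt α (betaCond M α) p) atTop (𝓝 0) := by
  have hM0 : (0 : ℝ) < M := by exact_mod_cast (by omega : 0 < M)
  have hlog : 0 < log M := log_pos (by exact_mod_cast hM)
  simp only [behEnt_eq_sum_mul_exp h0, betaCond]
  rw [show (0 : ℝ) = ∑ _i : Fin M, (0 : ℝ) by simp]
  refine tendsto_finsetSum _ fun i _ => ?_
  have hl : 0 < -log (p i) := neg_pos.2 (log_neg (h0 i) (h1 i))
  have hr : 0 < -log (p i) / log M := div_pos hl hlog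
  have hr1 : -log (p i) / log M ≠ 1 := by
    intro h
    rw [div_eq_one_iff_eq hlog.ne', ← log_inv] at h
    have := log_injOn_pos (Set.mem_Ioi.2 (inv_pos.2 (h0 i))) (Set.mem_Ioi.2 hM0) h
    exact hne i (by rw [one_div, ← this, inv_inv])
  have hv : ∀ α : ℝ, log M ^ (1 - α) * (-log (p i)) ^ α =
      log M * (-log (p i) / log M) ^ α := fun α => by
    rw [rpow_sub hlog, rpow_one, div_rpow hl.le hlog.le]
    ring
  simp only [hv]
  rcases lt_or_gt_of_ne hr1 with h | h
  · have ht := (tendsto_rpow_atTop_of_base_lt_one _ (by linarith) h).const_mul (log M)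
    simpa using ht.mul ht.neg.rexp
  · have ht := (tendsto_rpow_atTop_of_base_gt_one _ h).const_mul_atTop hlog
    simpa [Function.comp_def] using (Real.tendsto_pow_mul_exp_neg_atTop_nhds_zero 1).comp ht

end Behavioral

/-! ### Sensitivities -/

lemma measurable_renyiEnt_simplexParam (M : ℕ) (γ : ℝ) :
    Measurable fun x => renyiEnt γ (simplexParam M x) := by
  have h := measurable_simplexParam M
  unfold renyiEnt
  exact (Finset.measurable_sum _ fun i _ => (h i).pow_const γ).log.const_mul _

lemma measurable_minEnt_simplexParam (M : ℕ) :
    Measurable fun x => minEnt (simplexParam M x) :=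
  (Measurable.iSup (measurable_simplexParam M)).log.neg

lemma measurable_prelec (α β : ℝ) : Measurable (prelec α β) :=
  Measurable.ite (measurableSet_singleton 0) measurable_const
    ((measurable_log.neg.pow_const α).const_mul (-β)).exp

lemma measurable_behEnt_simplexParam (M : ℕ) (α β : ℝ) :
    Measurable fun x => behEnt α β (simplexParam M x) := by
  have h := fun i => (measurable_prelec α β).comp (measurable_simplexParam M i)
  exact (Finset.measurable_sum _ fun i _ => (h i).mul (h i).log).neg

lemma integrable_of_ae_mem_Icc {X : Type*} [MeasurableSpace X] {μ : Measure X} [IsFiniteMeasure μ]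
    {f : X → ℝ} (hf : Measurable f) {C : ℝ} (h : ∀ᵐ x ∂μ, f x ∈ Set.Icc 0 C) : Integrable f μ :=
  Integrable.of_bound hf.aestronglyMeasurable C <| h.mono fun x hx => by
    rw [norm_eq_abs, abs_of_nonneg hx.1]; exact hx.2

section Sensitivity

variable {M : ℕ}

lemma ae_minEnt_pos (hM : 2 ≤ M) : ∀ᵐ x ∂volume.restrict (simplexDomain (M - 1)),
    0 < minEnt (simplexParam M x) :=
  (ae_simplexParam_interior hM).mono fun _ hx =>
    minEnt_pos (by omega) (fun i => (hx i).1) fun i => (hx i).2.1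

lemma ae_minEnt_le_renyiEnt (hM : 2 ≤ M) {γ : ℝ} (hγ : 0 < γ) (hγ1 : γ ≠ 1) :
    ∀ᵐ x ∂volume.restrict (simplexDomain (M - 1)),
      minEnt (simplexParam M x) ≤ renyiEnt γ (simplexParam M x) :=
  (ae_simplexParam_interior hM).mono fun x hx =>
    minEnt_le_renyiEnt (fun i => (hx i).1.le) (sum_simplexParam (by omega) x) hγ hγ1

lemma ae_renyiEnt_le_log (hM : 2 ≤ M) {γ : ℝ} (hγ : 0 < γ) (hγ1 : γ ≠ 1) :
    ∀ᵐ x ∂volume.restrict (simplexDomain (M - 1)), renyiEnt γ (simplexParam M x) ≤ log M :=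
  (ae_simplexParam_interior hM).mono fun x hx =>
    renyiEnt_le_log (by omega) (fun i => (hx i).1.le) (sum_simplexParam (by omega) x) hγ hγ1

lemma ae_renyiEnt_mem_Icc (hM : 2 ≤ M) {γ : ℝ} (hγ : 0 < γ) (hγ1 : γ ≠ 1) :
    ∀ᵐ x ∂volume.restrict (simplexDomain (M - 1)),
      renyiEnt γ (simplexParam M x) ∈ Set.Icc 0 (log M) := by
  filter_upwards [ae_minEnt_pos hM, ae_minEnt_le_renyiEnt hM hγ hγ1, ae_renyiEnt_le_log hM hγ hγ1]
    with x h1 h2 h3 using ⟨h1.le.trans h2, h3⟩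

lemma integrable_renyiEnt (hM : 2 ≤ M) {γ : ℝ} (hγ : 0 < γ) (hγ1 : γ ≠ 1) :
    Integrable (fun x => renyiEnt γ (simplexParam M x))
      (volume.restrict (simplexDomain (M - 1))) :=
  integrable_of_ae_mem_Icc (measurable_renyiEnt_simplexParam M γ) (ae_renyiEnt_mem_Icc hM hγ hγ1)

lemma integrable_minEnt (hM : 2 ≤ M) :
    Integrable (fun x => minEnt (simplexParam M x)) (volume.restrict (simplexDomain (M - 1))) := by
  refine integrable_of_ae_mem_Icc (C := log M) (measurable_minEnt_simplexParam M) ?_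
  filter_upwards [ae_minEnt_pos hM, ae_minEnt_le_renyiEnt hM two_pos (by norm_num),
    ae_renyiEnt_le_log hM two_pos (by norm_num)] with x h1 h2 h3 using ⟨h1.le, h2.trans h3⟩

lemma sens_minEnt_pos (hM : 2 ≤ M) : 0 < sens M minEnt :=
  integral_pos_of_ae_pos (Measure.restrict_eq_zero.not.2 (volume_simplexDomain_ne_zero _))
    (integrable_minEnt hM) (ae_minEnt_pos hM)

lemma sens_minEnt_le_sens_renyiEnt (hM : 2 ≤ M) {γ : ℝ} (hγ : 0 < γ) (hγ1 : γ ≠ 1) :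
    sens M minEnt ≤ sens M (renyiEnt γ) :=
  integral_mono_ae (integrable_minEnt hM) (integrable_renyiEnt hM hγ hγ1)
    (ae_minEnt_le_renyiEnt hM hγ hγ1)

lemma sens_renyiEnt_le (hM : 2 ≤ M) {γ : ℝ} (hγ : 0 < γ) (hγ1 : γ ≠ 1) :
    sens M (renyiEnt γ) ≤ sens M fun _ => log M :=
  integral_mono_ae (integrable_renyiEnt hM hγ hγ1) (integrable_const _)
    (ae_renyiEnt_le_log hM hγ hγ1)

lemma sens_renyiEnt_two_lt (hM : 2 ≤ M) : sens M (renyiEnt 2) < sens M fun _ => log M := by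
  have hi := integrable_renyiEnt hM two_pos (by norm_num)
  have := integral_pos_of_ae_pos
    (Measure.restrict_eq_zero.not.2 (volume_simplexDomain_ne_zero (M - 1)))
    ((integrable_const (log M)).sub hi) <| (ae_simplexParam_interior hM).mono fun x hx =>
      sub_pos.2 <| renyiEnt_two_lt_log (by omega) (fun i => (hx i).1.le)
        (sum_simplexParam (by omega) x) fun i => (hx i).2.2
  simp only [Pi.sub_apply] at this
  rw [integral_sub (integrable_const _) hi] at this
  exact sub_pos.1 this

lemma eventually_nhdsGT_zero_ne_one : ∀ᶠ γ : ℝ in 𝓝[>] 0, 0 < γ ∧ γ ≠ 1 := by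
  filter_upwards [Ioo_mem_nhdsGT (zero_lt_one' ℝ)] with γ hγ using ⟨hγ.1, hγ.2.ne⟩

lemma tendsto_sens_of_ae {l : Filter ℝ} [l.IsCountablyGenerated] {F : ℝ → (Fin M → ℝ) → ℝ}
    {C c : ℝ} (hmeas : ∀ a, Measurable fun x => F a (simplexParam M x))
    (hbound : ∀ᶠ a in l, ∀ᵐ x ∂volume.restrict (simplexDomain (M - 1)),
      F a (simplexParam M x) ∈ Set.Icc 0 C)
    (hlim : ∀ᵐ x ∂volume.restrict (simplexDomain (M - 1)),
      Tendsto (fun a => F a (simplexParam M x)) l (𝓝 c)) :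
    Tendsto (fun a => sens M (F a)) l (𝓝 (sens M fun _ => c)) := by
  refine tendsto_integral_filter_of_dominated_convergence (fun _ => C)
    (Eventually.of_forall fun a => (hmeas a).aestronglyMeasurable) ?_ (integrable_const _) hlim
  refine hbound.mono fun a ha => ha.mono fun x hx => ?_
  rw [norm_eq_abs, abs_of_nonneg hx.1]
  exact hx.2

lemma tendsto_sens_renyiEnt_zero (hM : 2 ≤ M) :
    Tendsto (fun γ => sens M (renyiEnt γ)) (𝓝[>] 0) (𝓝 (sens M fun _ => log M)) :=
  tendsto_sens_of_ae (measurable_renyiEnt_simplexParam M)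
    (eventually_nhdsGT_zero_ne_one.mono fun _ hγ => ae_renyiEnt_mem_Icc hM hγ.1 hγ.2)
    ((ae_simplexParam_interior hM).mono fun _ hx =>
      tendsto_renyiEnt_zero (by omega) fun i => (hx i).1)

lemma betaCond_nonneg (M : ℕ) (α : ℝ) : 0 ≤ betaCond M α :=
  rpow_nonneg (log_natCast_nonneg M) _

lemma ae_behEnt_mem_Icc (hM : 2 ≤ M) (α : ℝ) :
    ∀ᵐ x ∂volume.restrict (simplexDomain (M - 1)),
      behEnt α (betaCond M α) (simplexParam M x) ∈ Set.Icc (0 : ℝ) M :=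
  (ae_simplexParam_interior hM).mono fun _ hx =>
    behEnt_mem_Icc (betaCond_nonneg M α) (fun i => (hx i).1.le) fun i => (hx i).2.1.le

lemma sens_behEnt_nonneg (hM : 2 ≤ M) (α : ℝ) : 0 ≤ sens M (behEnt α (betaCond M α)) :=
  integral_nonneg_of_ae ((ae_behEnt_mem_Icc hM α).mono fun _ hx => hx.1)

lemma sens_behEnt_le (hM : 2 ≤ M) (α : ℝ) :
    sens M (behEnt α (betaCond M α)) ≤ sens M fun _ => (M : ℝ) :=
  integral_mono_ae
    (integrable_of_ae_mem_Icc (measurable_behEnt_simplexParam M _ _) (ae_behEnt_mem_Icc hM α))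
    (integrable_const _) ((ae_behEnt_mem_Icc hM α).mono fun _ hx => hx.2)

lemma tendsto_sens_behEnt_zero (hM : 2 ≤ M) :
    Tendsto (fun α => sens M (behEnt α (betaCond M α))) (𝓝[>] 0)
      (𝓝 (sens M fun _ => log M)) :=
  tendsto_sens_of_ae (F := fun α => behEnt α (betaCond M α))
    (fun _ => measurable_behEnt_simplexParam M _ _)
    (Eventually.of_forall fun α => ae_behEnt_mem_Icc hM α)
    ((ae_simplexParam_interior hM).mono fun _ hx =>
      tendsto_behEnt_zero hM (fun i => (hx i).1) fun i => (hx i).2.1)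

lemma tendsto_sens_behEnt_atTop (hM : 2 ≤ M) :
    Tendsto (fun α => sens M (behEnt α (betaCond M α))) atTop (𝓝 0) := by
  have := tendsto_sens_of_ae (F := fun α => behEnt α (betaCond M α)) (l := atTop) (c := 0)
    (fun _ => measurable_behEnt_simplexParam M _ _)
    (Eventually.of_forall fun α => ae_behEnt_mem_Icc hM α)
    ((ae_simplexParam_interior hM).mono fun _ hx =>
      tendsto_behEnt_atTop hM (fun i => (hx i).1) (fun i => (hx i).2.1) fun i => (hx i).2.2)
  simpa [sens] using this

end Sensitivity

/-- Perceptiveness comparison: `P(H^B) > P(H^R) > 0`. -/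
theorem perceptiveness_comparison (M : ℕ) (hM : 2 ≤ M) :
    sSup ((fun α : ℝ => sens M (behEnt α (betaCond M α))) '' {α : ℝ | 0 < α ∧ α ≠ 1}) -
      sInf ((fun α : ℝ => sens M (behEnt α (betaCond M α))) '' {α : ℝ | 0 < α ∧ α ≠ 1}) >
    sSup ((fun γ : ℝ => sens M (renyiEnt γ)) '' {γ : ℝ | 0 < γ ∧ γ ≠ 1}) -
      sInf ((fun γ : ℝ => sens M (renyiEnt γ)) '' {γ : ℝ | 0 < γ ∧ γ ≠ 1}) ∧
    sSup ((fun γ : ℝ => sens M (renyiEnt γ)) '' {γ : ℝ | 0 < γ ∧ γ ≠ 1}) -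
      sInf ((fun γ : ℝ => sens M (renyiEnt γ)) '' {γ : ℝ | 0 < γ ∧ γ ≠ 1}) > 0 := by
  set B : ℝ → ℝ := fun α => sens M (behEnt α (betaCond M α))
  set R : ℝ → ℝ := fun γ => sens M (renyiEnt γ)
  set T : Set ℝ := {a | 0 < a ∧ a ≠ 1}
  have h2 : (2 : ℝ) ∈ T := ⟨two_pos, by norm_num⟩
  have hBabove : BddAbove (B '' T) := ⟨_, Set.forall_mem_image.2 fun α _ => sens_behEnt_le hM α⟩
  have hBbelow : BddBelow (B '' T) :=
    ⟨_, Set.forall_mem_image.2 fun α _ => sens_behEnt_nonneg hM α⟩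
  have hRle : ∀ y ∈ R '' T, y ≤ sens M fun _ => log M :=
    Set.forall_mem_image.2 fun γ hγ => sens_renyiEnt_le hM hγ.1 hγ.2
  have hRge : ∀ y ∈ R '' T, sens M minEnt ≤ y :=
    Set.forall_mem_image.2 fun γ hγ => sens_minEnt_le_sens_renyiEnt hM hγ.1 hγ.2
  have hBsup : (sens M fun _ => log M) ≤ sSup (B '' T) :=
    le_of_tendsto (tendsto_sens_behEnt_zero hM) <| eventually_nhdsGT_zero_ne_one.mono
      fun α hα => le_csSup hBabove (Set.mem_image_of_mem B hα)
  have hBinf : sInf (B '' T) ≤ 0 :=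
    ge_of_tendsto (tendsto_sens_behEnt_atTop hM) <| (eventually_gt_atTop 1).mono
      fun α hα => csInf_le hBbelow (Set.mem_image_of_mem B ⟨zero_lt_one.trans hα, hα.ne'⟩)
  have hRsup : (sens M fun _ => log M) ≤ sSup (R '' T) :=
    le_of_tendsto (tendsto_sens_renyiEnt_zero hM) <| eventually_nhdsGT_zero_ne_one.mono
      fun γ hγ => le_csSup ⟨_, hRle⟩ (Set.mem_image_of_mem R hγ)
  have hRsup' : sSup (R '' T) ≤ sens M fun _ => log M := csSup_le ⟨_, 2, h2, rfl⟩ hRle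
  have hRinf : sInf (R '' T) ≤ sens M (renyiEnt 2) :=
    csInf_le ⟨_, hRge⟩ (Set.mem_image_of_mem R h2)
  have hRinf' : sens M minEnt ≤ sInf (R '' T) := le_csInf ⟨_, 2, h2, rfl⟩ hRge
  have hmin := sens_minEnt_pos hM
  have htwo := sens_renyiEnt_two_lt hM
  constructor <;> linarith
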